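/- arXiv:1901.01697 — 3 statements merged into one kernel-verified Lean document; each statement's English description precedes it below -/
import Mathlib

section
/- There exists no cyclic multiplication operator on the Fock space 𝓕₂: if u is an entire function on ℂ such that the multiplication operator M_u : f ↦ u·f is bounded on 𝓕₂, then M_u is not cyclic on 𝓕₂. -/
open MeasureTheory Finset

/-- Squared Fock-space norm: ‖f‖₂² = (1/π)∫_ℂ |f(z)|² e^{-|z|²} dA(z). -/
noncomputable def fockNormSq (f : ℂ → ℂ) : ℝ :=
  (1 / Real.pi) * ∫ z : ℂ, ‖f z‖ ^ 2 * Real.exp (-‖z‖ ^ 2)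

/-- Membership in the Fock space 𝓕₂: entire and square Gaussian-integrable. -/
def MemFock (f : ℂ → ℂ) : Prop :=
  Differentiable ℂ f ∧
  Integrable (fun z : ℂ => ‖f z‖ ^ 2 * Real.exp (-‖z‖ ^ 2))

/-- Fock-space inner product ⟨f,g⟩ = (1/π)∫_ℂ f(z)·conj(g(z))·e^{-|z|²} dA(z). -/
noncomputable def fockInner (f g : ℂ → ℂ) : ℂ :=
  (1 / (Real.pi : ℂ)) * ∫ z : ℂ, f z * (starRingEnd ℂ) (g z) * (Real.exp (-‖z‖ ^ 2) : ℂ)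

/-- Reproducing kernel of the Fock space: K_w(z) = e^{z·conj(w)}. -/
noncomputable def fockKernel (w : ℂ) : ℂ → ℂ :=
  fun z => Complex.exp (z * (starRingEnd ℂ) w)

/-- Weighted composition operator W_{(u,ψ)} f = u·(f∘ψ). -/
def wComp (u ψ : ℂ → ℂ) (f : ℂ → ℂ) : ℂ → ℂ := fun z => u z * f (ψ z)

/-- Composition operator C_ψ f = f∘ψ. -/
def compOp (ψ : ℂ → ℂ) (f : ℂ → ℂ) : ℂ → ℂ := fun z => f (ψ z)

/-- Multiplication operator M_u f = u·f. -/
def mulOp (u : ℂ → ℂ) (f : ℂ → ℂ) : ℂ → ℂ := fun z => u z * f z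

/-- T maps 𝓕₂ into 𝓕₂ and is bounded there. -/
def FockBoundedOp (T : (ℂ → ℂ) → ℂ → ℂ) : Prop :=
  (∀ f, MemFock f → MemFock (T f)) ∧
  ∃ C : ℝ, 0 ≤ C ∧ ∀ f, MemFock f → fockNormSq (T f) ≤ C * fockNormSq f

/-- f is a cyclic vector for T on 𝓕₂: the linear span of the orbit
{Tⁿ f : n ≥ 0} is dense in 𝓕₂. -/
def IsCyclicVec (T : (ℂ → ℂ) → ℂ → ℂ) (f : ℂ → ℂ) : Prop :=
  MemFock f ∧ ∀ g, MemFock g → ∀ ε : ℝ, 0 < ε →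
    ∃ (n : ℕ) (c : Fin n → ℂ),
      fockNormSq (fun z => (∑ i : Fin n, c i * T^[(i : ℕ)] f z) - g z) < ε

/-- T is cyclic on 𝓕₂. -/
def IsCyclicOp (T : (ℂ → ℂ) → ℂ → ℂ) : Prop := ∃ f, IsCyclicVec T f

/-- T is hypercyclic on 𝓕₂: some orbit {Tⁿ f : n ≥ 0} is dense. -/
def IsHypercyclicOp (T : (ℂ → ℂ) → ℂ → ℂ) : Prop :=
  ∃ f, MemFock f ∧ ∀ g, MemFock g → ∀ ε : ℝ, 0 < ε →
    ∃ n : ℕ, fockNormSq (fun z => T^[n] f z - g z) < ε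

/-- T is supercyclic on 𝓕₂: some projective orbit {λTⁿ f} is dense. -/
def IsSupercyclicOp (T : (ℂ → ℂ) → ℂ → ℂ) : Prop :=
  ∃ f, MemFock f ∧ ∀ g, MemFock g → ∀ ε : ℝ, 0 < ε →
    ∃ (lam : ℂ) (n : ℕ), fockNormSq (fun z => lam * T^[n] f z - g z) < ε

/-- T is invertible as a bounded operator on 𝓕₂. -/
def FockOpInvertible (T : (ℂ → ℂ) → ℂ → ℂ) : Prop :=
  (∀ f, MemFock f → MemFock (T f)) ∧
  ∃ S : (ℂ → ℂ) → ℂ → ℂ,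
    (∀ f, MemFock f → MemFock (S f)) ∧
    (∀ f, MemFock f → S (T f) = f) ∧
    (∀ f, MemFock f → T (S f) = f) ∧
    ∃ C : ℝ, 0 ≤ C ∧ ∀ f, MemFock f → fockNormSq (S f) ≤ C * fockNormSq f

/-- μ is an eigenvalue of the Hilbert-space adjoint W_{(u,ψ)}*, expressed via the
inner product: W* g = μ g for a nonzero g ∈ 𝓕₂, i.e. ⟨Wf, g⟩ = conj(μ)·⟨f, g⟩
for all f ∈ 𝓕₂. -/
def IsAdjointEigenvalue (u ψ : ℂ → ℂ) (μ : ℂ) : Prop :=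
  ∃ g, MemFock g ∧ g ≠ 0 ∧ ∀ f, MemFock f →
    fockInner (wComp u ψ f) g = (starRingEnd ℂ) μ * fockInner f g

/-- Sub-mean value inequality for the square of the modulus of an entire function, over the orbit
of `z` under rotations. -/
lemma ofReal_norm_sq_zero_le_lintegral_circle {h : ℂ → ℂ} (hh : Differentiable ℂ h) (z : ℂ) :
    ENNReal.ofReal (2 * Real.pi) * ENNReal.ofReal (‖h 0‖ ^ 2) ≤
      ∫⁻ θ in Set.Ioc 0 (2 * Real.pi), ENNReal.ofReal (‖h (circleMap 0 1 θ * z)‖ ^ 2) := by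
  have hcont : Continuous fun θ : ℝ => h (circleMap 0 1 θ * z) ^ 2 :=
    (hh.continuous.comp ((continuous_circleMap 0 1).mul continuous_const)).pow 2
  have hmean : Real.circleAverage (fun ζ => h (ζ * z) ^ 2) 0 1 = h 0 ^ 2 := by
    have hd : Differentiable ℂ fun ζ => h (ζ * z) ^ 2 :=
      (hh.comp (differentiable_id.mul_const z)).pow 2
    simpa using (hd.diffContOnCl (s := Metric.ball 0 |1|)).circleAverage
  rw [Real.circleAverage_def] at hmean
  have hnorm : 2 * Real.pi * ‖h 0‖ ^ 2 ≤
      ∫ θ in (0 : ℝ)..2 * Real.pi, ‖h (circleMap 0 1 θ * z)‖ ^ 2 := by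
    rw [← norm_pow, ← hmean, norm_smul, norm_inv, Real.norm_of_nonneg Real.two_pi_pos.le,
      mul_inv_cancel_left₀ Real.two_pi_pos.ne']
    refine (intervalIntegral.norm_integral_le_integral_norm Real.two_pi_pos.le).trans ?_
    simp only [norm_pow, le_refl]
  rw [← ENNReal.ofReal_mul Real.two_pi_pos.le, ← ofReal_integral_eq_lintegral_ofReal]
  · rw [← intervalIntegral.integral_of_le Real.two_pi_pos.le]
    exact ENNReal.ofReal_le_ofReal hnorm
  · have := (hcont.norm.intervalIntegrable (μ := volume) 0 (2 * Real.pi)).1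
    simp only [norm_pow] at this
    exact this
  · exact Filter.Eventually.of_forall fun _ => sq_nonneg _

lemma lintegral_circleMap_mul (F : ℂ → ENNReal) (hF : Measurable F) (θ : ℝ) :
    ∫⁻ z, F (circleMap 0 1 θ * z) = ∫⁻ z, F z := by
  have := (rotation (Circle.exp θ)).measurePreserving.lintegral_comp hF
  simpa [circleMap, rotation_apply] using this

lemma integrable_exp_neg_norm_sq : Integrable fun z : ℂ => Real.exp (-‖z‖ ^ 2) := by
  have := (GaussianFourier.integrable_cexp_neg_mul_sq_norm_add (V := ℂ) (b := 1) (by simp) 0 0).norm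
  simpa [Complex.norm_exp, ← Complex.ofReal_pow] using this

lemma integral_exp_neg_norm_sq : ∫ z : ℂ, Real.exp (-‖z‖ ^ 2) = Real.pi := by
  have := GaussianFourier.integral_rexp_neg_mul_sq_norm (V := ℂ) (b := 1) one_pos
  simpa [Complex.finrank_real_complex] using this

lemma norm_sq_zero_le_fockNormSq {h : ℂ → ℂ} (hh : MemFock h) : ‖h 0‖ ^ 2 ≤ fockNormSq h := by
  obtain ⟨hd, hi⟩ := hh
  have hc := hd.continuous
  set G : ℂ → ENNReal := fun z => ENNReal.ofReal (‖h z‖ ^ 2 * Real.exp (-‖z‖ ^ 2)) with hG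
  have hGc : Continuous G := ENNReal.continuous_ofReal.comp (by fun_prop)
  have key : ENNReal.ofReal (2 * Real.pi) *
      ∫⁻ z : ℂ, ENNReal.ofReal (‖h 0‖ ^ 2) * ENNReal.ofReal (Real.exp (-‖z‖ ^ 2)) ≤
      ENNReal.ofReal (2 * Real.pi) * ∫⁻ z, G z := by
    calc
      _ = ∫⁻ z : ℂ, ENNReal.ofReal (2 * Real.pi) * ENNReal.ofReal (‖h 0‖ ^ 2) *
            ENNReal.ofReal (Real.exp (-‖z‖ ^ 2)) := by
          rw [← lintegral_const_mul' _ _ ENNReal.ofReal_ne_top]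
          simp only [mul_assoc]
      _ ≤ ∫⁻ z : ℂ, ∫⁻ θ in Set.Ioc 0 (2 * Real.pi), G (circleMap 0 1 θ * z) := by
          refine lintegral_mono fun z => ?_
          refine (mul_le_mul_left (ofReal_norm_sq_zero_le_lintegral_circle hd z) _).trans ?_
          rw [← lintegral_mul_const' _ _ ENNReal.ofReal_ne_top]
          simp [hG, ENNReal.ofReal_mul]
      _ = ∫⁻ θ in Set.Ioc 0 (2 * Real.pi), ∫⁻ z : ℂ, G (circleMap 0 1 θ * z) := by
          refine lintegral_lintegral_swap (Continuous.aemeasurable ?_)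
          exact hGc.comp (((continuous_circleMap 0 1).comp continuous_snd).mul continuous_fst)
      _ = _ := by
          simp_rw [lintegral_circleMap_mul G hGc.measurable]
          rw [setLIntegral_const, Real.volume_Ioc, sub_zero, mul_comm]
  rw [ENNReal.mul_le_mul_iff_right (by simp [Real.pi_pos]) ENNReal.ofReal_ne_top,
    lintegral_const_mul' _ _ ENNReal.ofReal_ne_top, hG,
    ← ofReal_integral_eq_lintegral_ofReal hi (Filter.Eventually.of_forall fun _ => by positivity),
    ← ofReal_integral_eq_lintegral_ofReal integrable_exp_neg_norm_sq
      (Filter.Eventually.of_forall fun _ => by positivity), integral_exp_neg_norm_sq,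
    ← ENNReal.ofReal_mul (by positivity),
    ENNReal.ofReal_le_ofReal_iff (integral_nonneg fun _ => by positivity)] at key
  rw [fockNormSq, one_div, inv_mul_eq_div, le_div_iff₀ Real.pi_pos]
  exact key

/-- Weighted translation `z ↦ h (z + w) e^{-z conj w}`, a scalar multiple of an isometry of the Fock
space. -/
noncomputable def fockTranslate (w : ℂ) (h : ℂ → ℂ) : ℂ → ℂ :=
  fun z => h (z + w) * Complex.exp (-(z * (starRingEnd ℂ) w))

lemma norm_sq_fockTranslate_mul_exp (w : ℂ) (h : ℂ → ℂ) (z : ℂ) :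
    ‖fockTranslate w h z‖ ^ 2 * Real.exp (-‖z‖ ^ 2) =
      Real.exp (‖w‖ ^ 2) * (‖h (z + w)‖ ^ 2 * Real.exp (-‖z + w‖ ^ 2)) := by
  have : Real.exp (-(z * (starRingEnd ℂ) w).re) ^ 2 * Real.exp (-‖z‖ ^ 2) =
      Real.exp (‖w‖ ^ 2) * Real.exp (-‖z + w‖ ^ 2) := by
    rw [← Real.exp_nat_mul, ← Real.exp_add, ← Real.exp_add]
    congr 1
    simp only [Complex.sq_norm, Complex.normSq_apply, Complex.add_re, Complex.add_im,
      Complex.mul_re, Complex.conj_re, Complex.conj_im]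
    push_cast
    ring
  rw [fockTranslate, norm_mul, Complex.norm_exp, Complex.neg_re, mul_pow, mul_assoc, this]
  ring

lemma MemFock.translate {h : ℂ → ℂ} (hh : MemFock h) (w : ℂ) : MemFock (fockTranslate w h) := by
  refine ⟨?_, ?_⟩
  · have := hh.1
    unfold fockTranslate
    fun_prop
  · simp_rw [norm_sq_fockTranslate_mul_exp]
    exact (hh.2.comp_add_right w).const_mul _

lemma fockNormSq_fockTranslate (w : ℂ) (h : ℂ → ℂ) :
    fockNormSq (fockTranslate w h) = Real.exp (‖w‖ ^ 2) * fockNormSq h := by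
  simp_rw [fockNormSq, norm_sq_fockTranslate_mul_exp]
  rw [integral_const_mul,
    integral_add_right_eq_self (fun z : ℂ => ‖h z‖ ^ 2 * Real.exp (-‖z‖ ^ 2)) w]
  ring

/-- Point evaluations are bounded on the Fock space. -/
lemma norm_sq_le_exp_mul_fockNormSq {h : ℂ → ℂ} (hh : MemFock h) (w : ℂ) :
    ‖h w‖ ^ 2 ≤ Real.exp (‖w‖ ^ 2) * fockNormSq h := by
  have := norm_sq_zero_le_fockNormSq (hh.translate w)
  rw [fockNormSq_fockTranslate] at this
  simpa [fockTranslate] using this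

lemma memFock_one : MemFock fun _ => 1 :=
  ⟨differentiable_const _, by simpa using integrable_exp_neg_norm_sq⟩

lemma fockNormSq_one : fockNormSq (fun _ => 1) = 1 := by
  simp [fockNormSq, integral_exp_neg_norm_sq, Real.pi_ne_zero]

lemma fockTranslate_neg_one (w : ℂ) : fockTranslate (-w) (fun _ => 1) = fockKernel w := by
  ext z
  simp [fockTranslate, fockKernel]

lemma memFock_fockKernel (w : ℂ) : MemFock (fockKernel w) :=
  fockTranslate_neg_one w ▸ memFock_one.translate (-w)

lemma fockNormSq_fockKernel (w : ℂ) : fockNormSq (fockKernel w) = Real.exp (‖w‖ ^ 2) := by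
  rw [← fockTranslate_neg_one, fockNormSq_fockTranslate, fockNormSq_one, norm_neg, mul_one]

/-- A bounded multiplication operator on the Fock space has a constant symbol. -/
lemma FockBoundedOp.exists_eq_const {u : ℂ → ℂ} (hu : Differentiable ℂ u)
    (hbdd : FockBoundedOp (mulOp u)) : ∃ c, ∀ z, u z = c := by
  obtain ⟨hmaps, C, -, hC⟩ := hbdd
  refine hu.exists_const_forall_eq_of_bounded
    (isBounded_iff_forall_norm_le.2 ⟨√C, Set.forall_mem_range.2 fun w => Real.le_sqrt_of_sq_le ?_⟩)
  have h := (norm_sq_le_exp_mul_fockNormSq (hmaps _ (memFock_fockKernel w)) w).trans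
    (mul_le_mul_of_nonneg_left (hC _ (memFock_fockKernel w)) (Real.exp_pos _).le)
  have hre : (w * (starRingEnd ℂ) w).re = ‖w‖ ^ 2 := by
    rw [Complex.mul_conj, Complex.ofReal_re, Complex.sq_norm]
  rw [fockNormSq_fockKernel, mulOp, fockKernel, norm_mul, Complex.norm_exp, hre] at h
  have hpos := Real.exp_pos (‖w‖ ^ 2)
  refine le_of_mul_le_mul_right ?_ (pow_pos hpos 2)
  linarith

lemma MemFock.const_mul_sub {f g : ℂ → ℂ} (hf : MemFock f) (hg : MemFock g) (a : ℂ) :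
    MemFock fun z => a * f z - g z := by
  have hd : Differentiable ℂ fun z => a * f z - g z := (hf.1.const_mul a).sub hg.1
  refine ⟨hd, ((hf.2.const_mul (2 * ‖a‖ ^ 2)).add (hg.2.const_mul 2)).mono' ?_ ?_⟩
  · have := hd.continuous
    exact Continuous.aestronglyMeasurable (by fun_prop)
  · refine Filter.Eventually.of_forall fun z => ?_
    rw [Real.norm_of_nonneg (by positivity)]
    have h1 : ‖a * f z - g z‖ ≤ ‖a‖ * ‖f z‖ + ‖g z‖ := (norm_sub_le _ _).trans (by rw [norm_mul])
    have h2 : ‖a * f z - g z‖ ^ 2 ≤ 2 * ‖a‖ ^ 2 * ‖f z‖ ^ 2 + 2 * ‖g z‖ ^ 2 := by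
      nlinarith [pow_le_pow_left₀ (norm_nonneg _) h1 2, sq_nonneg (‖a‖ * ‖f z‖ - ‖g z‖)]
    simp only [Pi.add_apply]
    nlinarith [mul_le_mul_of_nonneg_right h2 (Real.exp_pos (-‖z‖ ^ 2)).le]

lemma iterate_mulOp_apply {u : ℂ → ℂ} {c : ℂ} (hc : ∀ z, u z = c) (f : ℂ → ℂ) (n : ℕ) (z : ℂ) :
    (mulOp u)^[n] f z = c ^ n * f z := by
  induction n with
  | zero => simp
  | succ n ih => rw [Function.iterate_succ_apply', mulOp, ih, hc]; ring

/-- No line is dense in the Fock space. -/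
lemma not_forall_exists_fockNormSq_lt {f : ℂ → ℂ} (hf : MemFock f) :
    ¬ ∀ g, MemFock g → ∀ ε : ℝ, 0 < ε → ∃ a : ℂ, fockNormSq (fun z => a * f z - g z) < ε := by
  intro H
  have approx : ∀ g, MemFock g → ∀ ε : ℝ, 0 < ε → ∃ a : ℂ,
      ‖a * f 0 - g 0‖ < ε ∧ ‖a * f 1 - g 1‖ < ε := by
    intro g hg ε hε
    obtain ⟨a, ha⟩ := H g hg (Real.exp (-1) * ε ^ 2) (by positivity)
    have hm := hf.const_mul_sub hg a
    have hlt : Real.exp 1 * fockNormSq (fun z => a * f z - g z) < ε ^ 2 := by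
      calc _ < Real.exp 1 * (Real.exp (-1) * ε ^ 2) :=
            mul_lt_mul_of_pos_left ha (Real.exp_pos 1)
        _ = ε ^ 2 := by rw [← mul_assoc, ← Real.exp_add]; simp
    have h1 := norm_sq_le_exp_mul_fockNormSq hm 1
    have h0 := norm_sq_le_exp_mul_fockNormSq hm 0
    have hnonneg : 0 ≤ fockNormSq (fun z => a * f z - g z) :=
      (sq_nonneg _).trans (norm_sq_zero_le_fockNormSq hm)
    have he : (1 : ℝ) ≤ Real.exp 1 := Real.one_le_exp zero_le_one
    simp only [norm_zero, norm_one, one_pow, ne_eq, OfNat.ofNat_ne_zero, not_false_eq_true,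
      zero_pow, Real.exp_zero] at h0 h1
    refine ⟨a, lt_of_pow_lt_pow_left₀ 2 hε.le ?_, lt_of_pow_lt_pow_left₀ 2 hε.le (h1.trans_lt hlt)⟩
    nlinarith
  have hzero : ∀ g, MemFock g → f 1 * g 0 = f 0 * g 1 := by
    intro g hg
    rw [← sub_eq_zero, ← norm_le_zero_iff]
    refine le_of_forall_pos_le_add fun ε hε => ?_
    set M := ‖f 1‖ + ‖f 0‖ + 1 with hM
    have hMpos : 0 < M := by positivity
    obtain ⟨a, h0, h1⟩ := approx g hg (ε / M) (by positivity)
    calc ‖f 1 * g 0 - f 0 * g 1‖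
        = ‖f 0 * (a * f 1 - g 1) - f 1 * (a * f 0 - g 0)‖ := by congr 1; ring
      _ ≤ ‖f 0‖ * (ε / M) + ‖f 1‖ * (ε / M) := by
          refine (norm_sub_le _ _).trans ?_
          rw [norm_mul, norm_mul]
          gcongr
      _ ≤ M * (ε / M) := by
          rw [← add_mul]
          gcongr
          linarith
      _ = 0 + ε := by rw [zero_add]; field_simp
  have e1 := hzero _ (memFock_fockKernel 0)
  have e2 := hzero _ (memFock_fockKernel 1)
  simp only [fockKernel, map_zero, map_one, mul_zero, mul_one, Complex.exp_zero] at e1 e2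
  have hexp : Complex.exp 1 ≠ 1 := by
    intro h
    have := congrArg norm h
    rw [Complex.norm_exp, Complex.one_re, norm_one] at this
    exact (Real.one_lt_exp_iff.2 one_pos).ne' this
  have hf0 : f 0 = 0 := by
    have : f 0 * (Complex.exp 1 - 1) = 0 := by rw [mul_sub, ← e2, e1]; ring
    exact (mul_eq_zero.1 this).resolve_right (sub_ne_zero.2 hexp)
  obtain ⟨a, ha, -⟩ := approx _ memFock_one 1 one_pos
  simp [hf0] at ha

/-- there is no cyclic multiplication operator on 𝓕₂. -/
theorem multiplication_not_cyclic (u : ℂ → ℂ) (hu : Differentiable ℂ u)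
    (hbdd : FockBoundedOp (mulOp u)) :
    ¬ IsCyclicOp (mulOp u) := by
  rintro ⟨f, hf, hcyc⟩
  obtain ⟨c, hc⟩ := hbdd.exists_eq_const hu
  refine not_forall_exists_fockNormSq_lt hf fun g hg ε hε => ?_
  obtain ⟨n, b, hb⟩ := hcyc g hg ε hε
  refine ⟨∑ i : Fin n, b i * c ^ (i : ℕ), ?_⟩
  simpa only [iterate_mulOp_apply hc, ← mul_assoc, ← Finset.sum_mul] using hb
end

section
/- Let b ∈ ℂ with b ≠ 0, and define g(z) = (b/π)·sin(πz/b) for z ∈ ℂ. Then g is entire, g(−mb) = 0 for every integer m ≥ 0, g is not identically zero, and g belongs to the Fock space 𝓕₂, i.e. (1/π)∫_ℂ |g(z)|² e^{-|z|²} dA(z) < ∞. -/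
open MeasureTheory Finset

/-- The complex sine has exponential type at most one. -/
theorem norm_sin_le_exp_norm (w : ℂ) : ‖Complex.sin w‖ ≤ Real.exp ‖w‖ := by
  have h₁ : ‖Complex.exp (-w * Complex.I)‖ ≤ Real.exp ‖w‖ := by
    simpa using Complex.norm_exp_le_exp_norm (-w * Complex.I)
  have h₂ : ‖Complex.exp (w * Complex.I)‖ ≤ Real.exp ‖w‖ := by
    simpa using Complex.norm_exp_le_exp_norm (w * Complex.I)
  have h₃ := norm_sub_le (Complex.exp (-w * Complex.I)) (Complex.exp (w * Complex.I))
  rw [Complex.sin, norm_div, norm_mul, Complex.norm_I, Complex.norm_ofNat]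
  linarith

/-- Gaussians centred at the origin are integrable on the complex plane. -/
theorem integrable_exp_neg_mul_norm_sq {a : ℝ} (ha : 0 < a) :
    Integrable (fun z : ℂ => Real.exp (-a * ‖z‖ ^ 2)) := by
  have h := (GaussianFourier.integrable_cexp_neg_mul_sq_norm_add (V := ℂ) (b := (a : ℂ))
    (by simpa using ha) 0 0).norm
  refine h.congr (Filter.Eventually.of_forall fun z => ?_)
  simp [Complex.norm_exp, ← Complex.ofReal_pow]

/-- Entire functions of exponential type belong to the Fock space. -/
theorem memFock_of_norm_le_exp {f : ℂ → ℂ} (hf : Differentiable ℂ f) {C k : ℝ}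
    (h : ∀ z, ‖f z‖ ≤ C * Real.exp (k * ‖z‖)) : MemFock f := by
  refine ⟨hf, ?_⟩
  have hc : Continuous fun z : ℂ => ‖f z‖ ^ 2 * Real.exp (-‖z‖ ^ 2) := by
    have := hf.continuous
    fun_prop
  refine ((integrable_exp_neg_mul_norm_sq (a := 1 / 2) (by norm_num)).const_mul
    (C ^ 2 * Real.exp (2 * k ^ 2))).mono' hc.aestronglyMeasurable
    (Filter.Eventually.of_forall fun z => ?_)
  rw [Real.norm_of_nonneg (by positivity)]
  calc
    ‖f z‖ ^ 2 * Real.exp (-‖z‖ ^ 2)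
        ≤ (C * Real.exp (k * ‖z‖)) ^ 2 * Real.exp (-‖z‖ ^ 2) := by
      gcongr
      exact h z
    _ = C ^ 2 * Real.exp (2 * (k * ‖z‖) - ‖z‖ ^ 2) := by
      rw [mul_pow, mul_assoc, ← Real.exp_nat_mul, ← Real.exp_add]
      push_cast
      ring_nf
    _ ≤ C ^ 2 * Real.exp (2 * k ^ 2 + -(1 / 2) * ‖z‖ ^ 2) := by
      gcongr
      nlinarith [sq_nonneg (2 * k - ‖z‖)]
    _ = C ^ 2 * Real.exp (2 * k ^ 2) * Real.exp (-(1 / 2) * ‖z‖ ^ 2) := by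
      rw [Real.exp_add, mul_assoc]

/-- for b ≠ 0, g(z) = (b/π)·sin(πz/b) is entire, vanishes at -mb
for every m ≥ 0, is not identically zero, and belongs to 𝓕₂. -/
theorem sine_function_in_fock (b : ℂ) (hb : b ≠ 0) :
    Differentiable ℂ
        (fun z : ℂ => b / (Real.pi : ℂ) * Complex.sin ((Real.pi : ℂ) * z / b)) ∧
    (∀ m : ℕ,
      (fun z : ℂ => b / (Real.pi : ℂ) * Complex.sin ((Real.pi : ℂ) * z / b))
        (-((m : ℂ) * b)) = 0) ∧
    (fun z : ℂ => b / (Real.pi : ℂ) * Complex.sin ((Real.pi : ℂ) * z / b)) ≠ 0 ∧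
    MemFock
      (fun z : ℂ => b / (Real.pi : ℂ) * Complex.sin ((Real.pi : ℂ) * z / b)) := by
  have hπ : (Real.pi : ℂ) ≠ 0 := Complex.ofReal_ne_zero.mpr Real.pi_ne_zero
  have hd : Differentiable ℂ
      (fun z : ℂ => b / (Real.pi : ℂ) * Complex.sin ((Real.pi : ℂ) * z / b)) := by
    fun_prop
  refine ⟨hd, fun m => ?_, fun h => ?_, ?_⟩
  · have hm : (Real.pi : ℂ) * (-((m : ℂ) * b)) / b = -((m : ℂ) * Real.pi) := by
      field_simp
    simp only [hm, Complex.sin_neg, Complex.sin_nat_mul_pi, neg_zero, mul_zero]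
  · have h₀ := congrFun h (b / 2)
    have hm : (Real.pi : ℂ) * (b / 2) / b = Real.pi / 2 := by
      field_simp
    simp only [hm, Complex.sin_pi_div_two, mul_one, Pi.zero_apply] at h₀
    exact div_ne_zero hb hπ h₀
  · refine memFock_of_norm_le_exp hd (C := ‖b / (Real.pi : ℂ)‖)
      (k := ‖(Real.pi : ℂ) / b‖) fun z => ?_
    rw [← norm_mul ((Real.pi : ℂ) / b) z, div_mul_eq_mul_div (Real.pi : ℂ),
      norm_mul (b / (Real.pi : ℂ))]
    exact mul_le_mul_of_nonneg_left (norm_sin_le_exp_norm _) (norm_nonneg _)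
end

section
/- Let b ∈ ℂ, let ψ(z) = z + b, let u(z) = u₀·e^{−conj(b)·z} for a constant u₀ ∈ ℂ, and let W be the map (W f)(z) = u(z)·f(ψ(z)) on functions ℂ → ℂ. Then for every f : ℂ → ℂ, every m ∈ ℕ, and every z ∈ ℂ: (Wᵐ f)(z) = u₀^m · f(z + mb) · exp(−conj(b)·m·z − |b|²·m(m−1)/2). -/
open MeasureTheory Finset

/-- for ψ(z) = z + b and u(z) = u₀·e^{-conj(b)·z},
(Wᵐ f)(z) = u₀^m · f(z + mb) · exp(-conj(b)·m·z - |b|²·m(m-1)/2). -/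
theorem wComp_iterate_translation (b u₀ : ℂ) :
    ∀ (f : ℂ → ℂ) (m : ℕ) (z : ℂ),
      (wComp (fun w => u₀ * Complex.exp (-(starRingEnd ℂ) b * w))
          (fun w => w + b))^[m] f z =
        u₀ ^ m * f (z + (m : ℂ) * b) *
          Complex.exp (-(starRingEnd ℂ) b * (m : ℂ) * z -
            (‖b‖ : ℂ) ^ 2 * (m : ℂ) * ((m : ℂ) - 1) / 2) := by
  intro f m
  induction m with
  | zero => simp
  | succ m ih =>
    intro z
    have hb : (starRingEnd ℂ) b * b = (‖b‖ : ℂ) ^ 2 := Complex.conj_mul' b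
    rw [Function.iterate_succ_apply', wComp, ih]
    have harg : z + b + (m : ℂ) * b = z + ((m + 1 : ℕ) : ℂ) * b := by
      push_cast
      ring
    have hexp : -(starRingEnd ℂ) b * ((m + 1 : ℕ) : ℂ) * z -
          (‖b‖ : ℂ) ^ 2 * ((m + 1 : ℕ) : ℂ) * (((m + 1 : ℕ) : ℂ) - 1) / 2 =
        -(starRingEnd ℂ) b * z + (-(starRingEnd ℂ) b * (m : ℂ) * (z + b) -
          (‖b‖ : ℂ) ^ 2 * (m : ℂ) * ((m : ℂ) - 1) / 2) := by
      rw [← hb]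
      push_cast
      ring
    rw [harg, hexp, Complex.exp_add]
    ring
end
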